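/- arXiv:1609.01682 — 7 statements merged into one kernel-verified Lean document; each statement's English description precedes it below -/
import Mathlib

section
/- Let X and Y be nonempty finite subsets of C. Then X stochastically dominates Y under uniform tie-breaking if and only if u(X) > u(Y) for every utility function u consistent with ≻. -/
/-- `u : C → ℝ` is consistent with the preference order ≻ on `C`
(we model ≻ by a linear order, where larger means more preferred):
`u a > u b ↔ a ≻ b`. -/
def Consistent {C : Type*} [LinearOrder C] (u : C → ℝ) : Prop :=
  ∀ a b : C, u a > u b ↔ b < a

/-- The average utility `u(X)` of a finite set `X` (expected utility of a
uniformly random element of `X`). -/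
noncomputable def avg {C : Type*} (u : C → ℝ) (X : Finset C) : ℝ :=
  (∑ c ∈ X, u c) / (X.card : ℝ)

/-- `C^(j)`: the set of the `j` most-preferred candidates. -/
def topSet (C : Type*) [LinearOrder C] [Fintype C] (j : ℕ) : Finset C :=
  Finset.univ.filter fun c => (Finset.univ.filter fun d => c ≤ d).card ≤ j

/-- `X` stochastically dominates `Y` under uniform tie-breaking:
`|X ∩ C^(j)|/|X| ≥ |Y ∩ C^(j)|/|Y|` for every `j = 1, …, |C|`, strict for some `j`. -/
def StochDom {C : Type*} [LinearOrder C] [Fintype C] (X Y : Finset C) : Prop :=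
  (∀ j ∈ Finset.Icc 1 (Fintype.card C),
      ((Y ∩ topSet C j).card : ℝ) / (Y.card : ℝ) ≤ ((X ∩ topSet C j).card : ℝ) / (X.card : ℝ)) ∧
  (∃ j ∈ Finset.Icc 1 (Fintype.card C),
      ((Y ∩ topSet C j).card : ℝ) / (Y.card : ℝ) < ((X ∩ topSet C j).card : ℝ) / (X.card : ℝ))

/-- Core of match-domination, stated for lists `xs` (of length `k`) and `ys`
(of length `K ≥ k`) enumerated in increasing preference, where `le y x` means
`x ⪰ y` and `lt y x` means `x ≻ y`.  With 0-based indices, `r j = ⌈jK/k⌉ = (jK + k - 1)/k`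
and the block `Y_j` consists of positions `i` with `r j ≤ i < r (j+1)`. -/
def MatchDomCore {C : Type*} (le lt : C → C → Prop) (xs ys : List C) : Prop :=
  xs.length ≤ ys.length ∧
  (∀ (j : Fin xs.length) (i : Fin ys.length),
      (j.val * ys.length + xs.length - 1) / xs.length ≤ i.val →
      i.val < ((j.val + 1) * ys.length + xs.length - 1) / xs.length →
      le (ys.get i) (xs.get j)) ∧
  ((∃ (j : Fin xs.length) (i : Fin ys.length),
      (j.val * ys.length + xs.length - 1) / xs.length ≤ i.val ∧
      i.val < ((j.val + 1) * ys.length + xs.length - 1) / xs.length ∧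
      lt (ys.get i) (xs.get j)) ∨ ¬ (xs.length ∣ ys.length))

/-- `X` match-dominates `Y` according to the preference order.  If `|X| ≤ |Y|`
this is the ascending-enumeration condition; if `|X| > |Y|` it requires that `Y`
match-dominates `X` with respect to the reversed order. -/
def MatchDom {C : Type*} [LinearOrder C] (X Y : Finset C) : Prop :=
  if X.card ≤ Y.card then
    MatchDomCore (· ≤ ·) (· < ·) (X.sort (· ≤ ·)) (Y.sort (· ≤ ·))
  else
    MatchDomCore (· ≥ ·) (· > ·) ((Y.sort (· ≤ ·)).reverse) ((X.sort (· ≤ ·)).reverse)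


/-- The indicator of the set of candidates at least as preferred as `c`. -/
noncomputable def upperIndicator {C : Type*} [LinearOrder C] (c d : C) : ℝ :=
  if c ≤ d then 1 else 0

section

variable {C : Type*}

theorem avg_add (u v : C → ℝ) (X : Finset C) :
    avg (fun d => u d + v d) X = avg u X + avg v X := by
  simp only [avg, Finset.sum_add_distrib, add_div]

theorem avg_mul_left (r : ℝ) (u : C → ℝ) (X : Finset C) :
    avg (fun d => r * u d) X = r * avg u X := by
  simp only [avg, ← Finset.mul_sum, mul_div_assoc]

theorem avg_sum {ι : Type*} (s : Finset ι) (f : ι → C → ℝ) (X : Finset C) :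
    avg (fun d => ∑ i ∈ s, f i d) X = ∑ i ∈ s, avg (f i) X := by
  simp only [avg, ← Finset.sum_div]
  rw [Finset.sum_comm]

theorem avg_const (a : ℝ) {X : Finset C} (hX : X.Nonempty) : avg (fun _ => a) X = a := by
  have : (X.card : ℝ) ≠ 0 := by exact_mod_cast hX.card_pos.ne'
  simp [avg, this]

variable [LinearOrder C]

theorem consistent_iff_strictMono (u : C → ℝ) : Consistent u ↔ StrictMono u :=
  ⟨fun h a b hab => (h b a).2 hab, fun h _ _ => h.lt_iff_lt⟩

theorem upperIndicator_mono (c : C) : Monotone (upperIndicator c) := by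
  intro a b hab
  unfold upperIndicator
  split_ifs with h₁ h₂ <;> first | exact absurd (h₁.trans hab) h₂ | norm_num

theorem sum_mul_upperIndicator_of_forall_le (δ : C → ℝ) {s : Finset C} {d : C}
    (h : ∀ c ∈ s, c ≤ d) : ∑ c ∈ s, δ c * upperIndicator c d = ∑ c ∈ s, δ c :=
  Finset.sum_congr rfl fun c hc => by rw [upperIndicator, if_pos (h c hc), mul_one]

/-- A strictly monotone function bounded below by `a` is, on a finite set, the sum of `a` and
positive increments. -/
theorem StrictMono.exists_pos_increments {u : C → ℝ} (hu : StrictMono u) {a : ℝ}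
    (ha : ∀ d, a < u d) (s : Finset C) :
    ∃ δ : C → ℝ, (∀ c, 0 < δ c) ∧ ∀ d ∈ s, u d = a + ∑ c ∈ s, δ c * upperIndicator c d := by
  induction s using Finset.induction_on_max with
  | empty => exact ⟨fun _ => 1, fun _ => one_pos, by simp⟩
  | insert m s hm ih =>
    obtain ⟨δ, hδ, hs⟩ := ih
    have hms : m ∉ s := fun h => (hm m h).false
    have hlt : a + ∑ c ∈ s, δ c < u m := by
      rcases s.eq_empty_or_nonempty with rfl | hne
      · simpa using ha m
      · rw [← sum_mul_upperIndicator_of_forall_le δ (d := s.max' hne) fun c hc => s.le_max' c hc,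
          ← hs _ (s.max'_mem hne)]
        exact hu (hm _ (s.max'_mem hne))
    set δ' := Function.update δ m (u m - (a + ∑ c ∈ s, δ c)) with hδ'
    have hδ's : ∀ c ∈ s, δ' c = δ c := fun c hc => Function.update_of_ne (hm c hc).ne _ _
    have hδ'm : δ' m = u m - (a + ∑ c ∈ s, δ c) := Function.update_self ..
    have hsum : ∀ d, ∑ c ∈ s, δ' c * upperIndicator c d = ∑ c ∈ s, δ c * upperIndicator c d :=
      fun d => Finset.sum_congr rfl fun c hc => by rw [hδ's c hc]
    refine ⟨δ', fun c => ?_, fun d hd => ?_⟩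
    · by_cases h : c = m
      · rw [h, hδ'm]
        exact sub_pos.2 hlt
      · rw [hδ', Function.update_of_ne h]
        exact hδ c
    · rw [Finset.sum_insert hms, hδ'm, hsum]
      rcases Finset.mem_insert.1 hd with rfl | hd
      · rw [sum_mul_upperIndicator_of_forall_le δ fun c hc => (hm c hc).le, upperIndicator,
          if_pos le_rfl]
        ring
      · rw [hs d hd, upperIndicator, if_neg (hm d hd).not_ge, mul_zero, zero_add]

variable [Fintype C]

theorem mem_topSet {j : ℕ} {c : C} :
    c ∈ topSet C j ↔ (Finset.univ.filter fun d => c ≤ d).card ≤ j := by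
  simp [topSet]

theorem card_filter_ge_strictAnti :
    StrictAnti fun c : C => (Finset.univ.filter fun d => c ≤ d).card := by
  intro a b hab
  refine Finset.card_lt_card (Finset.ssubset_iff_subset_ne.2 ⟨fun d => ?_, fun h => ?_⟩)
  · simpa using hab.le.trans
  · have : a ∈ Finset.univ.filter fun d => b ≤ d := by simp [h]
    simp [hab.not_ge] at this

theorem exists_strictMono_real : ∃ u : C → ℝ, StrictMono u :=
  ⟨fun c => -((Finset.univ.filter fun d => c ≤ d).card : ℝ), fun _ _ hab =>
    neg_lt_neg (Nat.cast_lt.2 (card_filter_ge_strictAnti hab))⟩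

theorem card_inter_topSet_div {j : ℕ} {c : C} (h : ∀ d, d ∈ topSet C j ↔ c ≤ d) (X : Finset C) :
    ((X ∩ topSet C j).card : ℝ) / X.card = avg (upperIndicator c) X := by
  have : X ∩ topSet C j = X.filter fun d => c ≤ d := by
    ext d
    simp [h]
  simp [avg, upperIndicator, this]

theorem exists_mem_topSet_iff [Nonempty C] {j : ℕ} (hj : 1 ≤ j) :
    ∃ c : C, ∀ d, d ∈ topSet C j ↔ c ≤ d := by
  have hne : (topSet C j).Nonempty := by
    obtain ⟨m, hm⟩ := Finite.exists_max (id : C → C)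
    refine ⟨m, mem_topSet.2 (le_trans (Finset.card_le_one.2 fun x hx y hy => ?_) hj)⟩
    simp only [Finset.mem_filter_univ] at hx hy
    exact ((hm x).antisymm hx).trans (hy.antisymm (hm y))
  refine ⟨(topSet C j).min' hne, fun d => ⟨Finset.min'_le _ d, fun hd => ?_⟩⟩
  exact mem_topSet.2 ((card_filter_ge_strictAnti.antitone hd).trans
    (mem_topSet.1 (Finset.min'_mem _ hne)))

theorem exists_topSet_mem_iff (c : C) :
    ∃ j ∈ Finset.Icc 1 (Fintype.card C), ∀ d, d ∈ topSet C j ↔ c ≤ d :=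
  ⟨(Finset.univ.filter fun d => c ≤ d).card,
    Finset.mem_Icc.2 ⟨Finset.card_pos.2 ⟨c, by simp⟩, Finset.card_le_univ _⟩,
    fun _ => mem_topSet.trans card_filter_ge_strictAnti.le_iff_ge⟩

theorem stochDom_iff_avg_upperIndicator [Nonempty C] (X Y : Finset C) :
    StochDom X Y ↔ (∀ c, avg (upperIndicator c) Y ≤ avg (upperIndicator c) X) ∧
      ∃ c, avg (upperIndicator c) Y < avg (upperIndicator c) X := by
  constructor
  · rintro ⟨hle, j, hj, hlt⟩
    refine ⟨fun c => ?_, ?_⟩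
    · obtain ⟨i, hi, hc⟩ := exists_topSet_mem_iff c
      simpa only [card_inter_topSet_div hc] using hle i hi
    · obtain ⟨c, hc⟩ := exists_mem_topSet_iff (C := C) (Finset.mem_Icc.1 hj).1
      exact ⟨c, by simpa only [card_inter_topSet_div hc] using hlt⟩
  · rintro ⟨hle, c, hlt⟩
    refine ⟨fun j hj => ?_, ?_⟩
    · obtain ⟨c, hc⟩ := exists_mem_topSet_iff (C := C) (Finset.mem_Icc.1 hj).1
      simpa only [card_inter_topSet_div hc] using hle c
    · obtain ⟨j, hj, hc⟩ := exists_topSet_mem_iff c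
      exact ⟨j, hj, by simpa only [card_inter_topSet_div hc] using hlt⟩

theorem StrictMono.exists_avg_eq [Nonempty C] {u : C → ℝ} (hu : StrictMono u) :
    ∃ (a : ℝ) (δ : C → ℝ), (∀ c, 0 < δ c) ∧ ∀ X : Finset C, X.Nonempty →
      avg u X = a + ∑ c, δ c * avg (upperIndicator c) X := by
  obtain ⟨m, hm⟩ := Finite.exists_min u
  obtain ⟨δ, hδ, h⟩ := hu.exists_pos_increments (a := u m - 1)
    (fun d => by linarith [hm d]) Finset.univ
  refine ⟨u m - 1, δ, hδ, fun X hX => ?_⟩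
  have hu_eq : u = fun d => u m - 1 + ∑ c, δ c * upperIndicator c d :=
    funext fun d => h d (Finset.mem_univ d)
  rw [show avg u X = avg (fun d => u m - 1 + ∑ c, δ c * upperIndicator c d) X from
    congrArg (avg · X) hu_eq, avg_add, avg_const _ hX, avg_sum]
  simp only [avg_mul_left]

end

/-- `X` stochastically dominates `Y` under uniform tie-breaking iff
`u(X) > u(Y)` for every utility function `u` consistent with `≻`. -/
theorem stmt_0 {C : Type*} [LinearOrder C] [Fintype C] [Nonempty C]
    (X Y : Finset C) (hX : X.Nonempty) (hY : Y.Nonempty) :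
    StochDom X Y ↔ ∀ u : C → ℝ, Consistent u → avg u Y < avg u X := by
  rw [stochDom_iff_avg_upperIndicator]
  simp only [consistent_iff_strictMono]
  constructor
  · rintro ⟨hle, c, hlt⟩ u hu
    obtain ⟨a, δ, hδ, h⟩ := hu.exists_avg_eq
    rw [h X hX, h Y hY]
    gcongr 1
    exact Finset.sum_lt_sum (fun d _ => mul_le_mul_of_nonneg_left (hle d) (hδ d).le)
      ⟨c, Finset.mem_univ c, mul_lt_mul_of_pos_left hlt (hδ c)⟩
  · intro H
    obtain ⟨v, hv⟩ := exists_strictMono_real (C := C)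
    have hvXY := H v hv
    refine ⟨fun c => ?_, ?_⟩
    · refine le_of_forall_pos_le_add fun ε hε => ?_
      set r := ε / (avg v X - avg v Y)
      have hr0 : 0 < r := div_pos hε (sub_pos.2 hvXY)
      have hrε : r * (avg v X - avg v Y) = ε := div_mul_cancel₀ _ (sub_pos.2 hvXY).ne'
      have := H (fun d => upperIndicator c d + r * v d)
        ((upperIndicator_mono c).add_strictMono (hv.const_mul hr0))
      rw [avg_add, avg_add, avg_mul_left, avg_mul_left] at this
      linarith
    · by_contra! hge
      obtain ⟨a, δ, hδ, h⟩ := hv.exists_avg_eq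
      rw [h X hX, h Y hY] at hvXY
      refine hvXY.not_ge ?_
      gcongr with c
      · exact (hδ c).le
      · exact hge c
end

section
/- Let X and Y be nonempty finite subsets of C. If u(X) > u(Y) for every utility function u consistent with ≻, then X match-dominates Y according to ≻. -/
theorem exists_strictMono_real_s1 (C : Type*) [LinearOrder C] [Fintype C] :
    ∃ f : C → ℝ, StrictMono f := by
  refine ⟨fun c => ((Finset.univ.filter (· ≤ c)).card : ℝ), fun a b hab => ?_⟩
  refine Nat.cast_lt.2 (Finset.card_lt_card ?_)
  refine Finset.ssubset_iff_of_subset (fun d hd => ?_) |>.2 ⟨b, by simp, by simpa using hab⟩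
  simp only [Finset.mem_filter, Finset.mem_univ, true_and] at hd ⊢
  exact hd.trans hab.le

theorem list_avg_le_of_monotone {C : Type*} [LinearOrder C] [Fintype C] {xs ys : List C}
    (h : ∀ u : C → ℝ, Consistent u →
      (ys.map u).sum / (ys.length : ℝ) < (xs.map u).sum / (xs.length : ℝ))
    {g : C → ℝ} (hg : Monotone g) :
    (ys.map g).sum / (ys.length : ℝ) ≤ (xs.map g).sum / (xs.length : ℝ) := by
  obtain ⟨f, hf⟩ := exists_strictMono_real_s1 C
  by_contra! hlt
  set F := (ys.map f).sum / (ys.length : ℝ) - (xs.map f).sum / (xs.length : ℝ) with hF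
  set D := (ys.map g).sum / (ys.length : ℝ) - (xs.map g).sum / (xs.length : ℝ) with hD
  have hDpos : 0 < D := sub_pos.2 hlt
  have hFpos : 0 < |F| + 1 := by positivity
  set ε := D / (|F| + 1) with hε
  have hεpos : 0 < ε := by positivity
  have hεD : ε * (|F| + 1) = D := div_mul_cancel₀ _ hFpos.ne'
  have hmono : StrictMono fun c => ε * f c + g c := fun a b hab =>
    add_lt_add_of_lt_of_le (mul_lt_mul_of_pos_left (hf hab) hεpos) (hg hab.le)
  have hu := h (fun c => ε * f c + g c) fun a b => hmono.lt_iff_lt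
  simp only [List.sum_map_add, List.sum_map_mul_left, add_div, mul_div_assoc] at hu
  have hsum : ε * F + D < 0 := by rw [hF, hD]; linarith
  nlinarith [mul_le_mul_of_nonneg_left (neg_abs_le F) hεpos.le]

theorem countP_le_mul_length_le {C : Type*} [LinearOrder C] [Fintype C] {xs ys : List C}
    (hx : xs ≠ []) (hy : ys ≠ [])
    (h : ∀ u : C → ℝ, Consistent u →
      (ys.map u).sum / (ys.length : ℝ) < (xs.map u).sum / (xs.length : ℝ)) (t : C) :
    xs.countP (· ≤ t) * ys.length ≤ ys.countP (· ≤ t) * xs.length := by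
  have hg : Monotone fun c : C => if c ≤ t then (-1 : ℝ) else 0 := fun a b hab => by
    by_cases hb : b ≤ t
    · simp [hb, hab.trans hb]
    · simp only [hb, if_false]; split_ifs <;> norm_num
  have hcount : ∀ l : List C,
      (l.map fun c => if c ≤ t then (-1 : ℝ) else 0).sum = -(l.countP (· ≤ t) : ℝ) := fun l => by
    induction l with
    | nil => simp
    | cons a l ih =>
      rw [List.map_cons, List.sum_cons, ih, List.countP_cons]
      by_cases ha : a ≤ t <;> simp [ha]
  have key := list_avg_le_of_monotone h hg
  have hx' : (0 : ℝ) < xs.length := by exact_mod_cast List.length_pos_iff.2 hx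
  have hy' : (0 : ℝ) < ys.length := by exact_mod_cast List.length_pos_iff.2 hy
  rw [hcount, hcount, div_le_div_iff₀ hy' hx'] at key
  have : (xs.countP (· ≤ t) : ℝ) * ys.length ≤ ys.countP (· ≤ t) * xs.length := by linarith
  exact_mod_cast this

theorem getElem_le_of_lt_countP {C : Type*} [LinearOrder C] {l : List C}
    (hl : l.Pairwise (· < ·)) {i : ℕ} (hi : i < l.length) {t : C}
    (h : i < l.countP (· ≤ t)) : l[i] ≤ t := by
  by_contra! ht
  have hdrop : (l.drop i).countP (· ≤ t) = 0 := by
    refine List.countP_eq_zero.2 fun a ha => ?_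
    obtain ⟨n, hn, rfl⟩ := List.getElem_of_mem ha
    rw [List.getElem_drop]
    simpa using ht.trans_le (hl.sortedLT.sortedLE.getElem_le_getElem_of_le (Nat.le_add_right i n))
  rw [← List.take_append_drop i l, List.countP_append, hdrop] at h
  have := List.countP_le_length (p := (· ≤ t)) (l := l.take i)
  rw [List.length_take] at this
  omega

theorem lt_countP_getElem {C : Type*} [LinearOrder C] {l : List C}
    (hl : l.Pairwise (· < ·)) {j : ℕ} (hj : j < l.length) :
    j < l.countP (· ≤ l[j]) := by
  have htake : (l.take (j + 1)).countP (· ≤ l[j]) = (l.take (j + 1)).length := by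
    refine List.countP_eq_length.2 fun a ha => ?_
    obtain ⟨n, hn, rfl⟩ := List.getElem_of_mem ha
    rw [List.length_take] at hn
    rw [List.getElem_take]
    simpa using hl.sortedLT.sortedLE.getElem_le_getElem_of_le (by omega : n ≤ j)
  have := (List.take_sublist (j + 1) l).countP_le (p := (· ≤ l[j]))
  rw [htake, List.length_take] at this
  omega

theorem matchDomCore_of_list_avg_lt {C : Type*} [LinearOrder C] [Fintype C] {xs ys : List C}
    (hxs : xs.Pairwise (· < ·)) (hys : ys.Pairwise (· < ·)) (hx : xs ≠ []) (hy : ys ≠ [])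
    (hle : xs.length ≤ ys.length)
    (h : ∀ u : C → ℝ, Consistent u →
      (ys.map u).sum / (ys.length : ℝ) < (xs.map u).sum / (xs.length : ℝ)) :
    MatchDomCore (· ≤ ·) (· < ·) xs ys := by
  have hk : 0 < xs.length := List.length_pos_iff.2 hx
  have hK : 0 < ys.length := List.length_pos_iff.2 hy
  have hblock : ∀ (j : Fin xs.length) (i : Fin ys.length),
      (j.val * ys.length + xs.length - 1) / xs.length ≤ i.val →
      i.val < ((j.val + 1) * ys.length + xs.length - 1) / xs.length →
      ys.get i ≤ xs.get j := by
    intro j i _ hi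
    refine getElem_le_of_lt_countP hys i.2 ?_
    have h1 := (Nat.le_div_iff_mul_le hk).1 (Nat.succ_le_of_lt hi)
    have h2 := Nat.mul_le_mul_right ys.length (Nat.succ_le_of_lt (lt_countP_getElem hxs j.2))
    have h3 := countP_le_mul_length_le hx hy h xs[j.val]
    have h4 : i.val * xs.length < ys.countP (· ≤ xs[j.val]) * xs.length := by
      simp only [Nat.succ_eq_add_one, add_mul, one_mul] at h1 h2
      omega
    exact Nat.lt_of_mul_lt_mul_right h4
  refine ⟨hle, hblock, ?_⟩
  by_contra! hcon
  obtain ⟨hns, m, hm⟩ := hcon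
  have heq : ∀ (j : Fin xs.length) (i : Fin ys.length), j.val * m ≤ i.val →
      i.val < (j.val + 1) * m → ys.get i = xs.get j := by
    have hr : ∀ j : ℕ, (j * ys.length + xs.length - 1) / xs.length = j * m := fun j => by
      rw [hm, Nat.div_eq_of_lt_le]
      · have : j * (xs.length * m) = j * m * xs.length := by ring
        omega
      · have : (j * m + 1) * xs.length = j * (xs.length * m) + xs.length := by ring
        rw [this]
        omega
    intro j i h1 h2
    rw [← hr] at h1 h2
    exact le_antisymm (hblock j i h1 h2) (hns j i h1 h2)
  have hm0 : 0 < m := Nat.pos_of_ne_zero fun h0 => by simp [h0] at hm; exact hy hm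
  have hm1 : m = 1 := by
    by_contra hne
    have hm2 : 2 ≤ m := by omega
    have hK2 : 1 < ys.length := by rw [hm]; nlinarith
    have e0 := heq ⟨0, hk⟩ ⟨0, hK⟩ (by simp) (by simpa using hm0)
    have e1 := heq ⟨0, hk⟩ ⟨1, hK2⟩ (by simp) (by simpa using (by omega : 1 < m))
    have : ys[0] < ys[1] := hys.sortedLT.getElem_lt_getElem_of_lt zero_lt_one
    exact this.ne (e0.trans e1.symm)
  subst hm1
  have hxy : xs = ys := List.ext_getElem (by omega) fun n h1 h2 =>
    (heq ⟨n, h1⟩ ⟨n, h2⟩ (by simp) (by simp)).symm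
  subst hxy
  obtain ⟨f, hf⟩ := exists_strictMono_real_s1 C
  exact (h f fun a b => hf.lt_iff_lt).false

theorem sum_map_sort {C : Type*} [LinearOrder C] (u : C → ℝ) (X : Finset C) :
    ((X.sort (· ≤ ·)).map u).sum = ∑ c ∈ X, u c := by
  rw [Finset.sum_eq_multiset_sum, ← Finset.sort_eq X (· ≤ ·), Multiset.map_coe, Multiset.sum_coe]

/-- if `u(X) > u(Y)` for every utility function `u` consistent with `≻`,
then `X` match-dominates `Y` according to `≻`. -/
theorem stmt_1 {C : Type*} [LinearOrder C] [Fintype C] [Nonempty C]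
    (X Y : Finset C) (hX : X.Nonempty) (hY : Y.Nonempty)
    (h : ∀ u : C → ℝ, Consistent u → avg u Y < avg u X) :
    MatchDom X Y := by
  have hne : ∀ Z : Finset C, Z.Nonempty → Z.sort (· ≤ ·) ≠ [] := fun Z hZ =>
    List.length_pos_iff.1 (by simpa using hZ)
  unfold MatchDom
  split_ifs with hle
  · refine matchDomCore_of_list_avg_lt (Finset.sortedLT_sort X).pairwise
      (Finset.sortedLT_sort Y).pairwise (hne X hX) (hne Y hY) (by simpa using hle) fun u hu => ?_
    simpa only [avg, sum_map_sort, Finset.length_sort] using h u hu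
  · have hlen : ∀ Z : Finset C, (Z.sort (· ≤ ·)).reverse.length = Z.card := fun Z => by simp
    refine matchDomCore_of_list_avg_lt (C := Cᵒᵈ)
      (List.pairwise_reverse.2 (Finset.sortedLT_sort Y).pairwise)
      (List.pairwise_reverse.2 (Finset.sortedLT_sort X).pairwise)
      (mt List.reverse_eq_nil_iff.1 (hne Y hY)) (mt List.reverse_eq_nil_iff.1 (hne X hX))
      ((hlen Y).trans_le ((not_le.1 hle).le.trans_eq (hlen X).symm)) fun u hu => ?_
    have hneg : Consistent fun c : C => -u (OrderDual.toDual c) := fun a b =>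
      neg_lt_neg_iff.trans (hu (OrderDual.toDual b) (OrderDual.toDual a))
    have key := h _ hneg
    simp only [avg, Finset.sum_neg_distrib, neg_div, neg_lt_neg_iff] at key
    have hsum : ∀ Z : Finset C, ((Z.sort (· ≤ ·)).reverse.map fun c => u (OrderDual.toDual c)).sum
        = ∑ c ∈ Z, u (OrderDual.toDual c) := fun Z => by
      rw [← sum_map_sort, List.map_reverse, List.sum_reverse]
    calc _ = (∑ c ∈ X, u (OrderDual.toDual c)) / (X.card : ℝ) := by
          exact congrArg₂ (· / ·) (hsum X) (congrArg Nat.cast (hlen X))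
      _ < (∑ c ∈ Y, u (OrderDual.toDual c)) / (Y.card : ℝ) := key
      _ = _ := by
          exact (congrArg₂ (· / ·) (hsum Y) (congrArg Nat.cast (hlen Y))).symm
end

section
/- Let X and Y be nonempty finite subsets of C. Then X stochastically dominates Y under uniform tie-breaking if and only if X match-dominates Y according to ≻. -/
lemma ceil_div_le_iff {k : ℕ} (hk : 0 < k) (a i : ℕ) :
    (a + k - 1) / k ≤ i ↔ a ≤ k * i := by
  rw [← Nat.ceilDiv_eq_add_pred_div, ceilDiv_le_iff_le_mul hk]

lemma lt_ceil_div_iff {k : ℕ} (hk : 0 < k) (a i : ℕ) :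
    i < (a + k - 1) / k ↔ k * i < a := by
  rw [← not_le, ceil_div_le_iff hk, not_le]

/-- In a strictly increasing list, the members of a lower set form an initial segment. -/
lemma getElem_mem_iff_lt_countP {C : Type*} [LinearOrder C] {S : Finset C}
    (hS : IsLowerSet (S : Set C)) {l : List C} (hl : l.Pairwise (· < ·))
    {i : ℕ} (hi : i < l.length) : l[i] ∈ S ↔ i < l.countP (· ∈ S) := by
  induction l generalizing i with
  | nil => simp at hi
  | cons a t ih =>
    rw [List.pairwise_cons] at hl
    by_cases ha : a ∈ S
    · cases i with
      | zero => simp [ha]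
      | succ i => simp [ha, ih hl.2 (by simpa using hi)]
    · have ht : ∀ b ∈ t, b ∉ S := fun b hb hbS => ha (hS (hl.1 b hb).le hbS)
      have h0 : (a :: t).countP (· ∈ S) = 0 := by
        simpa [List.countP_eq_zero, ha] using ht
      rw [h0]
      cases i with
      | zero => simpa using ha
      | succ i => simpa using ht _ (List.getElem_mem _)

/-- The pointwise condition of match-domination says that every lower set has at most as large a
share of `xs` as of `ys`. -/
lemma forall_block_le_iff {C : Type*} [LinearOrder C] [Fintype C] {xs ys : List C}
    (hx : xs.Pairwise (· < ·)) (hy : ys.Pairwise (· < ·)) (hk : 0 < xs.length) :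
    (∀ (j : Fin xs.length) (i : Fin ys.length),
      (j.val * ys.length + xs.length - 1) / xs.length ≤ i.val →
      i.val < ((j.val + 1) * ys.length + xs.length - 1) / xs.length →
      ys.get i ≤ xs.get j) ↔
    ∀ S : Finset C, IsLowerSet (S : Set C) →
      ys.length * xs.countP (· ∈ S) ≤ xs.length * ys.countP (· ∈ S) := by
  simp only [ceil_div_le_iff hk, lt_ceil_div_iff hk, List.get_eq_getElem]
  constructor
  · intro h S hS
    by_contra! hlt
    set a := xs.countP (· ∈ S)
    set b := ys.countP (· ∈ S) with hb
    have ha : a ≤ xs.length := List.countP_le_length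
    have hbK : b < ys.length := by
      by_contra! hle
      have : ys.length * a ≤ b * xs.length := Nat.mul_le_mul hle ha
      linarith [Nat.mul_comm b xs.length]
    have hK : 0 < ys.length := by omega
    have hja : xs.length * b / ys.length < a := by
      rw [Nat.div_lt_iff_lt_mul hK]; linarith [Nat.mul_comm a ys.length]
    have h1 := h ⟨xs.length * b / ys.length, by omega⟩ ⟨b, hbK⟩
      (Nat.div_mul_le_self _ _) (Nat.lt_mul_of_div_lt (Nat.lt_succ_self _) hK)
    have h2 := (getElem_mem_iff_lt_countP hS hx (hja.trans_le ha)).2 hja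
    exact lt_irrefl b ((getElem_mem_iff_lt_countP hS hy hbK).1 (hS h1 h2))
  · rintro h ⟨j, hj⟩ ⟨i, hi⟩ - h2
    by_contra! hlt
    simp only at hlt h2
    have hS : IsLowerSet ((Finset.univ.filter (· < ys[i]) : Finset C) : Set C) :=
      fun a b hba ha => by
        simp only [Finset.coe_filter, Finset.mem_univ, true_and, Set.mem_ofPred_eq] at ha ⊢
        exact hba.trans_lt ha
    have h3 := (getElem_mem_iff_lt_countP hS hx hj).1 (by simpa using hlt)
    have h4 : ¬ _ := (getElem_mem_iff_lt_countP hS hy hi).not.1 (by simp)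
    have h5 := h _ hS
    rw [not_lt] at h4
    have h6 := Nat.mul_le_mul_left ys.length (Nat.succ_le_of_lt h3)
    have h7 := Nat.mul_le_mul_left xs.length h4
    have h8 : (j + 1) * ys.length ≤ xs.length * i := by
      rw [Nat.mul_comm]; exact h6.trans (h5.trans h7)
    omega

/-- Given the pointwise condition, the strictness condition of match-domination says that
the two lists differ. -/
lemma strict_or_not_dvd_iff_ne {C : Type*} [LinearOrder C] {xs ys : List C}
    (hy : ys.Pairwise (· < ·)) (hk : 0 < xs.length) (hkK : xs.length ≤ ys.length)
    (h : ∀ (j : Fin xs.length) (i : Fin ys.length),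
      (j.val * ys.length + xs.length - 1) / xs.length ≤ i.val →
      i.val < ((j.val + 1) * ys.length + xs.length - 1) / xs.length →
      ys.get i ≤ xs.get j) :
    ((∃ (j : Fin xs.length) (i : Fin ys.length),
      (j.val * ys.length + xs.length - 1) / xs.length ≤ i.val ∧
      i.val < ((j.val + 1) * ys.length + xs.length - 1) / xs.length ∧
      ys.get i < xs.get j) ∨ ¬ (xs.length ∣ ys.length)) ↔ xs ≠ ys := by
  simp only [ceil_div_le_iff hk, lt_ceil_div_iff hk, List.get_eq_getElem] at h ⊢
  constructor
  · rintro h' rfl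
    rcases h' with ⟨j, i, h1, h2, h3⟩ | h'
    · rw [Nat.mul_comm, Nat.mul_le_mul_left_iff hk] at h1
      rw [Nat.mul_comm (_ + 1), Nat.mul_lt_mul_left hk] at h2
      have hij : i = j := Fin.ext (by omega)
      subst hij
      exact lt_irrefl _ h3
    · exact h' dvd_rfl
  · intro hne
    by_contra! hcon
    obtain ⟨hns, m, hm⟩ := hcon
    apply hne
    have heq : ∀ (j i : ℕ) (hj : j < xs.length) (hi : i < ys.length),
        j * m ≤ i → i < (j + 1) * m → ys[i] = xs[j] := by
      intro j i hj hi h1 h2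
      have h1' : j * ys.length ≤ xs.length * i := by
        rw [hm, Nat.mul_left_comm]; exact Nat.mul_le_mul_left _ h1
      have h2' : xs.length * i < (j + 1) * ys.length := by
        rw [hm, Nat.mul_left_comm]; exact Nat.mul_lt_mul_of_pos_left h2 hk
      exact le_antisymm (h ⟨j, hj⟩ ⟨i, hi⟩ h1' h2') (hns ⟨j, hj⟩ ⟨i, hi⟩ h1' h2')
    have hm1 : m = 1 := by
      rcases Nat.lt_or_ge 1 m with hm2 | hm2
      · have hlen : 1 < ys.length := by
          rw [hm]; exact hm2.trans_le (Nat.le_mul_of_pos_left _ hk)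
        have e0 := heq 0 0 hk (by omega) (by simp) (by omega)
        have e1 := heq 0 1 hk hlen (by simp) (by omega)
        have := List.pairwise_iff_getElem.1 hy 0 1 (by omega) hlen one_pos
        rw [e0, e1] at this
        exact absurd this (lt_irrefl _)
      · interval_cases m
        · omega
        · rfl
    subst hm1
    exact List.ext_getElem (by omega) fun i h1 h2 =>
      (heq i i h1 h2 (by omega) (by omega)).symm

lemma matchDomCore_iff {C : Type*} [LinearOrder C] [Fintype C] {xs ys : List C}
    (hx : xs.Pairwise (· < ·)) (hy : ys.Pairwise (· < ·)) (hk : 0 < xs.length)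
    (hkK : xs.length ≤ ys.length) :
    MatchDomCore (· ≤ ·) (· < ·) xs ys ↔
      (∀ S : Finset C, IsLowerSet (S : Set C) →
        ys.length * xs.countP (· ∈ S) ≤ xs.length * ys.countP (· ∈ S)) ∧ xs ≠ ys := by
  rw [← forall_block_le_iff hx hy hk, MatchDomCore]
  constructor
  · rintro ⟨-, h1, h2⟩
    exact ⟨h1, (strict_or_not_dvd_iff_ne hy hk hkK h1).1 h2⟩
  · rintro ⟨h1, h2⟩
    exact ⟨hkK, h1, (strict_or_not_dvd_iff_ne hy hk hkK h1).2 h2⟩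

lemma matchDomCore_ge_iff {C : Type*} [LinearOrder C] [Fintype C] {xs ys : List C}
    (hx : xs.Pairwise (· > ·)) (hy : ys.Pairwise (· > ·)) (hk : 0 < xs.length)
    (hkK : xs.length ≤ ys.length) :
    MatchDomCore (· ≥ ·) (· > ·) xs ys ↔
      (∀ U : Finset C, IsUpperSet (U : Set C) →
        ys.length * xs.countP (· ∈ U) ≤ xs.length * ys.countP (· ∈ U)) ∧ xs ≠ ys := by
  have h := matchDomCore_iff (C := Cᵒᵈ) hx hy hk hkK
  refine h.trans (and_congr_left' (forall_congr' fun U => imp_congr ?_ Iff.rfl))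
  exact ⟨fun hU a b hab ha => hU hab ha, fun hU a b hab ha => hU hab ha⟩

lemma countP_sort_mem {C : Type*} [LinearOrder C] (X S : Finset C) :
    (X.sort (· ≤ ·)).countP (· ∈ S) = (X ∩ S).card := by
  rw [← Multiset.coe_countP, Finset.sort_eq, Multiset.countP_eq_card_filter,
    ← Finset.filter_mem_eq_inter]
  rfl

lemma sort_inj {C : Type*} [LinearOrder C] {X Y : Finset C} :
    X.sort (· ≤ ·) = Y.sort (· ≤ ·) ↔ X = Y :=
  ⟨fun h => by simpa using congrArg List.toFinset h, fun h => h ▸ rfl⟩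

/-- A lower-set comparison is the upper-set comparison of the complements. -/
lemma forall_lower_iff_forall_upper {C : Type*} [LinearOrder C] [Fintype C] (X Y : Finset C) :
    (∀ S : Finset C, IsLowerSet (S : Set C) →
      Y.card * (X ∩ S).card ≤ X.card * (Y ∩ S).card) ↔
    ∀ U : Finset C, IsUpperSet (U : Set C) →
      X.card * (Y ∩ U).card ≤ Y.card * (X ∩ U).card := by
  have hcard : ∀ Z S : Finset C, (Z ∩ S).card + (Z ∩ Sᶜ).card = Z.card := fun Z S => by
    rw [← Finset.sdiff_eq_inter_compl, Finset.card_inter_add_card_sdiff]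
  have hcompl : ∀ S : Finset C,
      Y.card * (X ∩ S).card ≤ X.card * (Y ∩ S).card ↔
        X.card * (Y ∩ Sᶜ).card ≤ Y.card * (X ∩ Sᶜ).card := fun S => by
    have h1 : Y.card * ((X ∩ S).card + (X ∩ Sᶜ).card) =
        X.card * ((Y ∩ S).card + (Y ∩ Sᶜ).card) := by
      rw [hcard, hcard, Nat.mul_comm]
    rw [Nat.mul_add, Nat.mul_add] at h1
    omega
  constructor
  · intro h U hU
    simpa using (hcompl Uᶜ).1 (h Uᶜ (by rw [Finset.coe_compl]; exact hU.compl))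
  · intro h S hS
    exact (hcompl S).2 (h Sᶜ (by rw [Finset.coe_compl]; exact hS.compl))

lemma matchDom_iff {C : Type*} [LinearOrder C] [Fintype C] {X Y : Finset C}
    (hX : X.Nonempty) (hY : Y.Nonempty) :
    MatchDom X Y ↔
      (∀ U : Finset C, IsUpperSet (U : Set C) →
        X.card * (Y ∩ U).card ≤ Y.card * (X ∩ U).card) ∧ X ≠ Y := by
  have hs : ∀ Z : Finset C, (Z.sort (· ≤ ·)).Pairwise (· < ·) := fun Z =>
    (Finset.sortedLT_sort Z).pairwise
  unfold MatchDom
  split_ifs with h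
  · rw [matchDomCore_iff (hs X) (hs Y) (by simpa using hX.card_pos) (by simpa using h),
      ← forall_lower_iff_forall_upper]
    simp only [countP_sort_mem, Finset.length_sort, ne_eq, sort_inj]
  · rw [matchDomCore_ge_iff (List.pairwise_reverse.2 (hs Y)) (List.pairwise_reverse.2 (hs X))
      (by simpa using hY.card_pos) (by simpa using (not_le.1 h).le)]
    simp only [List.countP_reverse, countP_sort_mem, List.length_reverse, Finset.length_sort,
      ne_eq, List.reverse_inj, sort_inj, eq_comm (a := Y)]

lemma isUpperSet_topSet (C : Type*) [LinearOrder C] [Fintype C] (j : ℕ) :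
    IsUpperSet (topSet C j : Set C) := by
  intro a b hab ha
  simp only [topSet, Finset.coe_filter, Finset.mem_univ, true_and, Set.mem_ofPred_eq] at ha ⊢
  exact (Finset.card_le_card (Finset.monotone_filter_right _ fun d _ hd => hab.trans hd)).trans ha

lemma topSet_card_of_isUpperSet {C : Type*} [LinearOrder C] [Fintype C] {U : Finset C}
    (hU : IsUpperSet (U : Set C)) : topSet C U.card = U := by
  ext c
  simp only [topSet, Finset.mem_filter, Finset.mem_univ, true_and]
  constructor
  · intro h
    by_contra hc
    have hsub : U ⊂ Finset.univ.filter fun d => c ≤ d := by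
      refine Finset.ssubset_iff_subset_ne.2 ⟨fun d hd => ?_, ?_⟩
      · simp only [Finset.mem_filter, Finset.mem_univ, true_and]
        by_contra hlt
        exact hc (hU (not_le.1 hlt).le hd)
      · rintro rfl
        simp at hc
    exact absurd (Finset.card_lt_card hsub) (not_lt.2 h)
  · intro hc
    exact Finset.card_le_card fun d hd => hU (by simpa using hd) hc

/-- Finite sets with equal shares in all upper sets are equal. -/
lemma eq_of_forall_upper_eq {C : Type*} [LinearOrder C] [Fintype C] {X Y : Finset C}
    (hX : X.Nonempty) (hY : Y.Nonempty)
    (h : ∀ U : Finset C, IsUpperSet (U : Set C) →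
      X.card * (Y ∩ U).card = Y.card * (X ∩ U).card) : X = Y := by
  ext c
  have h1 := h (Finset.univ.filter (c ≤ ·)) fun a b hab ha => by
    simp only [Finset.coe_filter, Finset.mem_univ, true_and, Set.mem_ofPred_eq] at ha ⊢
    exact ha.trans hab
  have h2 := h (Finset.univ.filter (c < ·)) fun a b hab ha => by
    simp only [Finset.coe_filter, Finset.mem_univ, true_and, Set.mem_ofPred_eq] at ha ⊢
    exact ha.trans_le hab
  have hstep : ∀ Z : Finset C, (Z ∩ Finset.univ.filter (c ≤ ·)).card =
      (Z ∩ Finset.univ.filter (c < ·)).card + if c ∈ Z then 1 else 0 := fun Z => by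
    split_ifs with hc
    · rw [← Finset.card_insert_of_notMem (a := c) (by simp)]
      congr 1
      ext d
      simp only [Finset.mem_inter, Finset.mem_filter, Finset.mem_univ, true_and,
        Finset.mem_insert, le_iff_lt_or_eq]
      grind
    · congr 1
      ext d
      simp only [Finset.mem_inter, Finset.mem_filter, Finset.mem_univ, true_and,
        le_iff_lt_or_eq]
      grind
  rw [hstep, hstep, Nat.mul_add, Nat.mul_add, h2] at h1
  have hX' := hX.card_pos
  have hY' := hY.card_pos
  split_ifs at h1 <;> simp_all

lemma stochDom_iff {C : Type*} [LinearOrder C] [Fintype C] {X Y : Finset C}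
    (hX : X.Nonempty) (hY : Y.Nonempty) :
    StochDom X Y ↔
      (∀ U : Finset C, IsUpperSet (U : Set C) →
        X.card * (Y ∩ U).card ≤ Y.card * (X ∩ U).card) ∧ X ≠ Y := by
  have hX' : (0 : ℝ) < X.card := by exact_mod_cast hX.card_pos
  have hY' : (0 : ℝ) < Y.card := by exact_mod_cast hY.card_pos
  have hmem : ∀ U : Finset C, U.Nonempty → U.card ∈ Finset.Icc 1 (Fintype.card C) :=
    fun U hU => Finset.mem_Icc.2 ⟨hU.card_pos, Finset.card_le_univ U⟩
  have hle : ∀ U : Finset C,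
      ((Y ∩ U).card : ℝ) / Y.card ≤ ((X ∩ U).card : ℝ) / X.card ↔
        X.card * (Y ∩ U).card ≤ Y.card * (X ∩ U).card := fun U => by
    rw [div_le_div_iff₀ hY' hX', mul_comm, mul_comm ((X ∩ U).card : ℝ)]
    exact_mod_cast Iff.rfl
  unfold StochDom
  simp only [← not_le (a := ((X ∩ _).card : ℝ) / _)]
  constructor
  · rintro ⟨h, j, -, hlt⟩
    refine ⟨fun U hU => ?_, ?_⟩
    · rcases U.eq_empty_or_nonempty with rfl | hne
      · simp
      · have := h _ (hmem U hne)
        rwa [topSet_card_of_isUpperSet hU, hle] at this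
    · rintro rfl
      exact hlt le_rfl
  · rintro ⟨h, hne⟩
    refine ⟨fun j _ => (hle _).2 (h _ (isUpperSet_topSet C j)), ?_⟩
    by_contra! hcon
    refine hne (eq_of_forall_upper_eq hX hY fun U hU => (h U hU).antisymm ?_)
    rcases U.eq_empty_or_nonempty with rfl | hUne
    · simp
    · have := hcon _ (hmem U hUne)
      rw [topSet_card_of_isUpperSet hU, div_le_div_iff₀ hX' hY', mul_comm,
        mul_comm ((Y ∩ U).card : ℝ)] at this
      exact_mod_cast this

/-- `X` stochastically dominates `Y` under uniform tie-breaking iff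
`X` match-dominates `Y` according to `≻`. -/
theorem stmt_3 {C : Type*} [LinearOrder C] [Fintype C] [Nonempty C]
    (X Y : Finset C) (hX : X.Nonempty) (hY : Y.Nonempty) :
    StochDom X Y ↔ MatchDom X Y := by
  rw [stochDom_iff hX hY, matchDom_iff hX hY]
end

section
/- (Axiom MD entails Axiom G.) Let (⪰̂, ≻̂) be any pair of relations on nonempty multisets over C that respects Monotone Duplication. Then the Gärdenfors axiom holds: for every nonempty finite subset A ⊆ C and every b ∈ C∖A with b ≻ a for all a ∈ A, one has {b} ≻̂ {b} ∪ A and {b} ∪ A ≻̂ A. -/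
/-- The multiset obtained from the finite set `X` by duplicating each `x ∈ X` into
`h x` copies. -/
def dupMultiset {C : Type*} [DecidableEq C] (h : C → ℕ) (X : Finset C) : Multiset C :=
  ∑ x ∈ X, Multiset.replicate (h x) x

/-- The pair of relations `(weak, strict)` (i.e. `(⪰̂, ≻̂)`) on nonempty multisets
over `C` respects Monotone Duplication: for a finite set `X` enumerated in increasing
preference and a nonempty multiset `Y` consisting of `h x` copies of each `x ∈ X`,
(MD1) if `h` is non-decreasing along the preference then `Y ⪰̂ X`, (MD2) if it is
non-increasing then `X ⪰̂ Y`, and (MD3) if moreover the multiplicities are not all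
equal then the corresponding preference is strict. -/
def RespectsMD {C : Type*} [LinearOrder C]
    (weak strict : Multiset C → Multiset C → Prop) : Prop :=
  ∀ (X : Finset C) (h : C → ℕ), X.Nonempty → dupMultiset h X ≠ 0 →
    ((∀ a ∈ X, ∀ b ∈ X, a ≤ b → h a ≤ h b) →
      weak (dupMultiset h X) X.val ∧
      ((∃ a ∈ X, ∃ b ∈ X, h a ≠ h b) → strict (dupMultiset h X) X.val)) ∧
    ((∀ a ∈ X, ∀ b ∈ X, a ≤ b → h b ≤ h a) →
      weak X.val (dupMultiset h X) ∧
      ((∃ a ∈ X, ∃ b ∈ X, h a ≠ h b) → strict X.val (dupMultiset h X)))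

/-- Duplicating each element of `S` once and every other element of `X` zero times yields `S`. -/
lemma dupMultiset_indicator {C : Type*} [DecidableEq C] {S X : Finset C} (hS : S ⊆ X) :
    dupMultiset (fun x => if x ∈ S then 1 else 0) X = S.val := by
  have h : ∀ x, Multiset.replicate (if x ∈ S then 1 else 0) x
      = if x ∈ S then ({x} : Multiset C) else 0 := by
    intro x
    split_ifs <;> simp
  simp only [dupMultiset, h]
  rw [Finset.sum_ite_mem, Finset.inter_eq_right.mpr hS, Finset.sum_multiset_singleton]

/-- Axiom MD entails Axiom G: if the pair `(⪰̂, ≻̂)` respects Monotone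
Duplication, then for every nonempty finite `A ⊆ C` and `b ∉ A` with `b ≻ a` for all
`a ∈ A`, we have `{b} ≻̂ {b} ∪ A` and `{b} ∪ A ≻̂ A`. -/
theorem stmt_11 {C : Type*} [LinearOrder C] [Fintype C] [Nonempty C]
    (weak strict : Multiset C → Multiset C → Prop)
    (hMD : RespectsMD weak strict)
    (A : Finset C) (hA : A.Nonempty) (b : C) (hbA : b ∉ A) (hb : ∀ a ∈ A, a < b) :
    strict {b} (insert b A).val ∧ strict (insert b A).val A.val := by
  obtain ⟨a, ha⟩ := hA
  have hne : (insert b A).Nonempty := Finset.insert_nonempty b A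
  have hdb := dupMultiset_indicator (Finset.singleton_subset_iff.mpr (Finset.mem_insert_self b A))
  have hdA := dupMultiset_indicator (Finset.subset_insert b A)
  have hab : a ≠ b := (hb a ha).ne
  have hmono : ∀ x ∈ insert b A, ∀ y ∈ insert b A, x ≤ y → x = b → y = b := by
    rintro x - y hy hxy rfl
    rcases Finset.mem_insert.mp hy with h | h
    · exact h
    · exact absurd (hb y h) hxy.not_gt
  constructor
  · have hMDb := (hMD (insert b A) (fun x => if x ∈ ({b} : Finset C) then 1 else 0) hne
      (by rw [hdb]; simp)).1
    rw [hdb] at hMDb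
    refine (hMDb fun x hx y hy hxy => ?_).2 ⟨a, by simp [ha], b, by simp, by simp [hab]⟩
    have := hmono x hx y hy hxy
    simp only [Finset.mem_singleton]
    split_ifs <;> simp_all
  · have hMDA := (hMD (insert b A) (fun x => if x ∈ A then 1 else 0) hne
      (by rw [hdA]; exact fun h => by simp [Finset.val_eq_zero.mp h] at ha)).2
    rw [hdA] at hMDA
    refine (hMDA fun x hx y hy hxy => ?_).2 ⟨a, by simp [ha], b, by simp, by simp [ha, hbA]⟩
    have := hmono x hx y hy hxy
    have := Finset.mem_insert.mp hx
    split_ifs <;> simp_all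
end

section
/- (Soundness of the axiomatic entailment K+G+R.) If X ≻̂ Y holds in the entailment closure of the axioms K+G+R and transitivity, then u(X) > u(Y) for every utility function u consistent with ≻; and if X ⪰̂ Y, then u(X) ≥ u(Y) for every such u. -/
/-- The entailment closure of the axioms K+G+R and transitivity on nonempty finite
subsets of `C`.  `KGR true X Y` means `X ≻̂ Y` and `KGR false X Y` means `X ⪰̂ Y`.
The preference `≻` is modelled by the linear order (larger = more preferred). -/
inductive KGR {C : Type*} [LinearOrder C] : Bool → Finset C → Finset C → Prop
  /-- K1: if `a ≻ b` for all `a ∈ X`, `b ∈ Y` then `X ≻̂ Y`. -/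
  | k1 {X Y : Finset C} (hX : X.Nonempty) (hY : Y.Nonempty)
      (h : ∀ a ∈ X, ∀ b ∈ Y, b < a) : KGR true X Y
  /-- K2: if `a ⪰ b` for all `a ∈ X`, `b ∈ Y` then `X ⪰̂ Y`. -/
  | k2 {X Y : Finset C} (hX : X.Nonempty) (hY : Y.Nonempty)
      (h : ∀ a ∈ X, ∀ b ∈ Y, b ≤ a) : KGR false X Y
  /-- G (first part): if `a ≻ b` for all `b ∈ X` (`a ∉ X`, `X` nonempty) then
  `{a} ≻̂ {a} ∪ X`. -/
  | g1 {a : C} {X : Finset C} (hX : X.Nonempty) (haX : a ∉ X)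
      (h : ∀ b ∈ X, b < a) : KGR true {a} (insert a X)
  /-- G (second part): if `a ≻ b` for all `b ∈ X` (`a ∉ X`, `X` nonempty) then
  `{a} ∪ X ≻̂ X`. -/
  | g2 {a : C} {X : Finset C} (hX : X.Nonempty) (haX : a ∉ X)
      (h : ∀ b ∈ X, b < a) : KGR true (insert a X) X
  /-- R: if `a ≻ b` and `W ⊆ C∖{a,b}` then `{a} ∪ W ≻̂ {b} ∪ W`. -/
  | r {a b : C} {W : Finset C} (hab : b < a) (haW : a ∉ W) (hbW : b ∉ W) :
      KGR true (insert a W) (insert b W)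
  /-- `≻̂` is contained in `⪰̂`. -/
  | strict_le {X Y : Finset C} : KGR true X Y → KGR false X Y
  /-- `⪰̂` is transitive. -/
  | trans_ww {X Y Z : Finset C} : KGR false X Y → KGR false Y Z → KGR false X Z
  /-- `X ≻̂ Y ⪰̂ Z` implies `X ≻̂ Z`. -/
  | trans_sw {X Y Z : Finset C} : KGR true X Y → KGR false Y Z → KGR true X Z
  /-- `X ⪰̂ Y ≻̂ Z` implies `X ≻̂ Z`. -/
  | trans_ws {X Y Z : Finset C} : KGR false X Y → KGR true Y Z → KGR true X Z

lemma avg_lt_of_forall_lt {C : Type*} {u : C → ℝ} {X : Finset C} {m : ℝ} (hX : X.Nonempty)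
    (h : ∀ c ∈ X, u c < m) : avg u X < m := by
  have hcard : (0 : ℝ) < X.card := by exact_mod_cast hX.card_pos
  rw [avg, div_lt_iff₀ hcard]
  calc ∑ c ∈ X, u c < ∑ _c ∈ X, m := Finset.sum_lt_sum_of_nonempty hX h
    _ = m * X.card := by rw [Finset.sum_const, nsmul_eq_mul, mul_comm]

lemma avg_le_of_forall_le {C : Type*} {u : C → ℝ} {X : Finset C} {m : ℝ} (hX : X.Nonempty)
    (h : ∀ c ∈ X, u c ≤ m) : avg u X ≤ m := by
  have hcard : (0 : ℝ) < X.card := by exact_mod_cast hX.card_pos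
  rw [avg, div_le_iff₀ hcard]
  calc ∑ c ∈ X, u c ≤ ∑ _c ∈ X, m := Finset.sum_le_sum h
    _ = m * X.card := by rw [Finset.sum_const, nsmul_eq_mul, mul_comm]

lemma le_avg_of_forall_le {C : Type*} {u : C → ℝ} {X : Finset C} {m : ℝ} (hX : X.Nonempty)
    (h : ∀ c ∈ X, m ≤ u c) : m ≤ avg u X := by
  have hcard : (0 : ℝ) < X.card := by exact_mod_cast hX.card_pos
  rw [avg, le_div_iff₀ hcard]
  calc m * X.card = ∑ _c ∈ X, m := by rw [Finset.sum_const, nsmul_eq_mul, mul_comm]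
    _ ≤ ∑ c ∈ X, u c := Finset.sum_le_sum h

lemma avg_singleton {C : Type*} (u : C → ℝ) (a : C) : avg u {a} = u a := by
  simp [avg]

lemma avg_insert {C : Type*} [DecidableEq C] (u : C → ℝ) {a : C} {X : Finset C} (ha : a ∉ X) :
    avg u (insert a X) = (u a + ∑ c ∈ X, u c) / (X.card + 1) := by
  rw [avg, Finset.sum_insert ha, Finset.card_insert_of_notMem ha, Nat.cast_succ]

lemma avg_lt_avg_insert {C : Type*} [DecidableEq C] {u : C → ℝ} {a : C} {X : Finset C}
    (hX : X.Nonempty) (ha : a ∉ X) (h : ∀ b ∈ X, u b < u a) :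
    avg u X < avg u (insert a X) := by
  have hcard : (0 : ℝ) < X.card := by exact_mod_cast hX.card_pos
  have hlt := avg_lt_of_forall_lt hX h
  rw [avg, div_lt_iff₀ hcard] at hlt
  rw [avg_insert u ha, avg, div_lt_div_iff₀ hcard (by positivity)]
  linarith

/-- Every pair in the entailment closure is ordered weakly by average utility, and strictly when
the entailment is strict. -/
lemma KGR.avg_le_and_avg_lt {C : Type*} [LinearOrder C] {u : C → ℝ} (hu : Consistent u)
    {s : Bool} {X Y : Finset C} (h : KGR s X Y) :
    avg u Y ≤ avg u X ∧ (s = true → avg u Y < avg u X) := by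
  have hmono : StrictMono u := fun a b hab => (hu b a).2 hab
  have of_lt : ∀ {s : Bool} {X Y : Finset C}, avg u Y < avg u X →
      avg u Y ≤ avg u X ∧ (s = true → avg u Y < avg u X) := fun h => ⟨h.le, fun _ => h⟩
  induction h with
  | k1 hX hY h =>
    exact of_lt <|
      (avg_lt_of_forall_lt hY fun b hb => hmono (h _ (Finset.min'_mem _ hX) b hb)).trans_le <|
      (le_avg_of_forall_le hX fun a ha => hmono.monotone (Finset.min'_le _ a ha))
  | k2 hX hY h =>
    refine ⟨avg_le_of_forall_le hY fun b hb => ?_, nofun⟩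
    exact le_avg_of_forall_le hX fun a ha => hmono.monotone (h a ha b hb)
  | @g1 a X hX haX h =>
    have hsum : ∑ c ∈ X, u c < u a * X.card := by
      have hcard : (0 : ℝ) < X.card := by exact_mod_cast hX.card_pos
      exact (div_lt_iff₀ hcard).1 (avg_lt_of_forall_lt hX fun b hb => hmono (h b hb))
    refine of_lt ?_
    rw [avg_singleton, avg_insert u haX, div_lt_iff₀ (by positivity)]
    linarith
  | g2 hX haX h =>
    exact of_lt (avg_lt_avg_insert hX haX fun b hb => hmono (h b hb))
  | r hab haW hbW =>
    refine of_lt ?_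
    rw [avg_insert u haW, avg_insert u hbW]
    gcongr
    exact hmono hab
  | strict_le _ ih => exact ⟨ih.1, nofun⟩
  | trans_ww _ _ ih₁ ih₂ => exact ⟨ih₂.1.trans ih₁.1, nofun⟩
  | trans_sw _ _ ih₁ ih₂ => exact of_lt (ih₂.1.trans_lt (ih₁.2 rfl))
  | trans_ws _ _ ih₁ ih₂ => exact of_lt ((ih₂.2 rfl).trans_le ih₁.1)

/-- Soundness of the axiomatic entailment K+G+R: if `X ≻̂ Y` is in the
entailment closure of K+G+R and transitivity then `u(X) > u(Y)` for every utility `u`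
consistent with `≻`; and if `X ⪰̂ Y` then `u(X) ≥ u(Y)` for every such `u`. -/
theorem stmt_15 {C : Type*} [LinearOrder C] [Fintype C] [Nonempty C]
    (X Y : Finset C) (u : C → ℝ) (hu : Consistent u) :
    (KGR true X Y → avg u Y < avg u X) ∧ (KGR false X Y → avg u Y ≤ avg u X) :=
  ⟨fun h => (h.avg_le_and_avg_lt hu).2 rfl, fun h => (h.avg_le_and_avg_lt hu).1⟩
end

section
/- (Completeness of the axioms K+MD+R for match-domination.) Let X and Y be nonempty finite subsets of C such that X match-dominates Y according to ≻. Then X ≻̂ Y holds in the entailment closure of the axioms K+MD+R and transitivity on multisets. -/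
/-- The entailment closure of the axioms K+MD+R and transitivity on nonempty
multisets over `C`.  `KMDR true X Y` means `X ≻̂ Y` and `KMDR false X Y` means
`X ⪰̂ Y`.  The preference `≻` is modelled by the linear order (larger = more
preferred); a finite subset is viewed as the multiset in which every element has
multiplicity one. -/
inductive KMDR {C : Type*} [LinearOrder C] : Bool → Multiset C → Multiset C → Prop
  /-- K1: if `a ≻ b` for all `a ∈ X`, `b ∈ Y` then `X ≻̂ Y`. -/
  | k1 {X Y : Multiset C} (hX : X ≠ 0) (hY : Y ≠ 0)
      (h : ∀ a ∈ X, ∀ b ∈ Y, b < a) : KMDR true X Y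
  /-- K2: if `a ⪰ b` for all `a ∈ X`, `b ∈ Y` then `X ⪰̂ Y`. -/
  | k2 {X Y : Multiset C} (hX : X ≠ 0) (hY : Y ≠ 0)
      (h : ∀ a ∈ X, ∀ b ∈ Y, b ≤ a) : KMDR false X Y
  /-- R1: if `a ≻ b` then `{a} + W ≻̂ {b} + W` for every multiset `W`. -/
  | r1 {a b : C} {W : Multiset C} (hab : b < a) : KMDR true (a ::ₘ W) (b ::ₘ W)
  /-- R2: if `a ⪰ b` then `{a} + W ⪰̂ {b} + W` for every multiset `W`. -/
  | r2 {a b : C} {W : Multiset C} (hab : b ≤ a) : KMDR false (a ::ₘ W) (b ::ₘ W)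
  /-- MD1: if `Y` consists of `h x ≥ 0` copies of each `x` in the finite set `X`
  (`Y` nonempty), with non-decreasing multiplicities along the preference, then
  `Y ⪰̂ X`. -/
  | md1 {X : Finset C} {h : C → ℕ} (hX : X.Nonempty) (hne : dupMultiset h X ≠ 0)
      (hmono : ∀ a ∈ X, ∀ b ∈ X, a ≤ b → h a ≤ h b) :
      KMDR false (dupMultiset h X) X.val
  /-- MD1+MD3: as MD1, with not all multiplicities equal: `Y ≻̂ X`. -/
  | md1s {X : Finset C} {h : C → ℕ} (hX : X.Nonempty) (hne : dupMultiset h X ≠ 0)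
      (hmono : ∀ a ∈ X, ∀ b ∈ X, a ≤ b → h a ≤ h b)
      (hstrict : ∃ a ∈ X, ∃ b ∈ X, h a ≠ h b) :
      KMDR true (dupMultiset h X) X.val
  /-- MD2: with non-increasing multiplicities along the preference, `X ⪰̂ Y`. -/
  | md2 {X : Finset C} {h : C → ℕ} (hX : X.Nonempty) (hne : dupMultiset h X ≠ 0)
      (hanti : ∀ a ∈ X, ∀ b ∈ X, a ≤ b → h b ≤ h a) :
      KMDR false X.val (dupMultiset h X)
  /-- MD2+MD3: as MD2, with not all multiplicities equal: `X ≻̂ Y`. -/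
  | md2s {X : Finset C} {h : C → ℕ} (hX : X.Nonempty) (hne : dupMultiset h X ≠ 0)
      (hanti : ∀ a ∈ X, ∀ b ∈ X, a ≤ b → h b ≤ h a)
      (hstrict : ∃ a ∈ X, ∃ b ∈ X, h a ≠ h b) :
      KMDR true X.val (dupMultiset h X)
  /-- `≻̂` is contained in `⪰̂`. -/
  | strict_le {X Y : Multiset C} : KMDR true X Y → KMDR false X Y
  /-- `⪰̂` is transitive. -/
  | trans_ww {X Y Z : Multiset C} : KMDR false X Y → KMDR false Y Z → KMDR false X Z
  /-- `X ≻̂ Y ⪰̂ Z` implies `X ≻̂ Z`. -/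
  | trans_sw {X Y Z : Multiset C} : KMDR true X Y → KMDR false Y Z → KMDR true X Z
  /-- `X ⪰̂ Y ≻̂ Z` implies `X ≻̂ Z`. -/
  | trans_ws {X Y Z : Multiset C} : KMDR false X Y → KMDR true Y Z → KMDR true X Z

theorem KMDR.refl {C : Type*} [LinearOrder C] {W : Multiset C} (hW : W ≠ 0) : KMDR false W W := by
  obtain ⟨a, ha⟩ := Multiset.exists_mem_of_ne_zero hW
  obtain ⟨V, rfl⟩ := Multiset.exists_cons_of_mem ha
  exact .r2 le_rfl

/-- Replacing elements of a nonempty multiset by weakly worse ones yields a weakly worse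
multiset. -/
theorem KMDR.map_add {C ι : Type*} [LinearOrder C] {f g : ι → C} {M : Multiset ι}
    (hM : ∀ i ∈ M, g i ≤ f i) {W : Multiset C} (hne : M.map f + W ≠ 0) :
    KMDR false (M.map f + W) (M.map g + W) := by
  induction M using Multiset.induction_on generalizing W with
  | empty => exact .refl hne
  | cons i M ih =>
    have hstep : KMDR false (f i ::ₘ (M.map f + W)) (g i ::ₘ (M.map f + W)) :=
      .r2 (hM i (Multiset.mem_cons_self i M))
    have hrest := ih (fun j hj => hM j (Multiset.mem_cons_of_mem hj)) (W := g i ::ₘ W) (by simp)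
    rw [Multiset.add_cons, Multiset.add_cons] at hrest
    rw [Multiset.map_cons, Multiset.map_cons, Multiset.cons_add, Multiset.cons_add]
    exact .trans_ww hstep hrest

/-- Replacing elements of a multiset by weakly worse ones, one of them strictly worse, yields a
strictly worse multiset. -/
theorem KMDR.map_of_lt {C ι : Type*} [LinearOrder C] {f g : ι → C} {M : Multiset ι}
    (hM : ∀ i ∈ M, g i ≤ f i) (hlt : ∃ i ∈ M, g i < f i) :
    KMDR true (M.map f) (M.map g) := by
  obtain ⟨i, hi, hlt⟩ := hlt
  obtain ⟨M, rfl⟩ := Multiset.exists_cons_of_mem hi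
  have hrest := KMDR.map_add (fun j hj => hM j (Multiset.mem_cons_of_mem hj))
    (W := {g i}) (by simp)
  rw [add_comm, add_comm (M.map g), Multiset.singleton_add, Multiset.singleton_add] at hrest
  rw [Multiset.map_cons, Multiset.map_cons]
  exact .trans_sw (.r1 hlt) hrest

theorem dupMultiset_const {C : Type*} [DecidableEq C] (n : ℕ) (X : Finset C) :
    dupMultiset (fun _ => n) X = n • X.val := by
  simp only [dupMultiset, ← Multiset.nsmul_singleton, Finset.sum_nsmul,
    Finset.sum_multiset_singleton]

theorem Multiset.map_div_range_mul {C : Type*} (f : ℕ → C) (k : ℕ) {n : ℕ} (hn : 0 < n) :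
    (Multiset.range (k * n)).map (fun p => f (p / n)) = n • (Multiset.range k).map f := by
  induction k with
  | zero => simp
  | succ k ih =>
    have hblock : (Multiset.range n).map (fun p => f ((k * n + p) / n)) =
        Multiset.replicate n (f k) := by
      rw [← Multiset.card_range n, ← Multiset.map_const', Multiset.card_range]
      refine Multiset.map_congr rfl fun p hp => ?_
      rw [Multiset.mem_range] at hp
      rw [mul_comm, Nat.mul_add_div hn, Nat.div_eq_of_lt hp, add_zero]
    rw [Nat.succ_mul, Multiset.range_add, Multiset.map_add, ih, Multiset.map_map,
      Multiset.range_succ, Multiset.map_cons, Multiset.nsmul_cons, Multiset.nsmul_singleton,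
      add_comm]
    exact congrArg (· + _) hblock

theorem List.coe_eq_map_getD_range {C : Type*} (l : List C) (d : C) :
    (l : Multiset C) = (Multiset.range l.length).map (fun i => l.getD i d) := by
  change _ = ((List.map _ (List.range l.length) : List C) : Multiset C)
  congr 1
  refine List.ext_getElem (by simp) fun i hi _ => ?_
  simp [hi]

/-- Duplicating all elements of `X` and `Y` to a common cardinality and comparing pointwise. -/
theorem KMDR.of_getD {C : Type*} [LinearOrder C] {X Y : Finset C} (hX : X.Nonempty)
    (hY : Y.Nonempty) {xs ys : List C} (hxs : (xs : Multiset C) = X.val)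
    (hys : (ys : Multiset C) = Y.val) (d : C)
    (hle : ∀ p < xs.length * ys.length,
      ys.getD (p / xs.length) d ≤ xs.getD (p / ys.length) d)
    (hlt : ∃ p < xs.length * ys.length,
      ys.getD (p / xs.length) d < xs.getD (p / ys.length) d) :
    KMDR true X.val Y.val := by
  have hxc : xs.length = X.card := congrArg Multiset.card hxs
  have hyc : ys.length = Y.card := congrArg Multiset.card hys
  have hxp : 0 < xs.length := hxc ▸ hX.card_pos
  have hyp : 0 < ys.length := hyc ▸ hY.card_pos
  have hmid : KMDR true (dupMultiset (fun _ => ys.length) X)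
      (dupMultiset (fun _ => xs.length) Y) := by
    have h := KMDR.map_of_lt (M := Multiset.range (xs.length * ys.length))
      (fun p hp => hle p (Multiset.mem_range.1 hp))
      (hlt.imp fun p hp => ⟨Multiset.mem_range.2 hp.1, hp.2⟩)
    rw [Multiset.map_div_range_mul (fun i => xs.getD i d) _ hyp, mul_comm,
      Multiset.map_div_range_mul (fun i => ys.getD i d) _ hxp,
      ← List.coe_eq_map_getD_range, ← List.coe_eq_map_getD_range, hxs, hys] at h
    rwa [dupMultiset_const, dupMultiset_const]
  have hdup {n : ℕ} {Z : Finset C} (hn : 0 < n) (hZ : Z.Nonempty) :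
      dupMultiset (fun _ => n) Z ≠ 0 := by
    rw [dupMultiset_const, ← Multiset.card_pos, Multiset.card_nsmul]
    exact Nat.mul_pos hn hZ.card_pos
  exact .trans_ws (.md2 hX (hdup hyp hX) fun _ _ _ _ _ => le_rfl)
    (.trans_sw hmid (.md1 hY (hdup hxp hY) fun _ _ _ _ _ => le_rfl))

/-- Index `i` lies in the block of the index `k * i / K`. -/
theorem mem_block_iff {k K i j : ℕ} (hk : 0 < k) (hK : 0 < K) :
    ((j * K + k - 1) / k ≤ i ∧ i < ((j + 1) * K + k - 1) / k) ↔ k * i / K = j := by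
  have ceil_le (m : ℕ) : (m + k - 1) / k ≤ i ↔ m ≤ k * i := by
    rw [← Nat.lt_add_one_iff, Nat.div_lt_iff_lt_mul hk, Nat.add_mul, mul_comm i]
    omega
  rw [ceil_le, ← not_le, ceil_le, not_le, Nat.div_eq_iff hK, Nat.add_mul]
  omega

/-- Match-domination compares the lists pointwise after duplicating all their elements to a
common length. -/
theorem MatchDomCore.getD {C : Type*} {le lt : C → C → Prop} {xs ys : List C}
    (h : MatchDomCore le lt xs ys) (hne : xs ≠ []) (hs : xs.Pairwise lt)
    (hlt_le : ∀ {a b}, lt a b → le a b)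
    (htrans : ∀ {a b c}, le a b → lt b c → lt a c) (d : C) :
    (∀ p < xs.length * ys.length,
      le (ys.getD (p / xs.length) d) (xs.getD (p / ys.length) d)) ∧
    ∃ p < xs.length * ys.length,
      lt (ys.getD (p / xs.length) d) (xs.getD (p / ys.length) d) := by
  obtain ⟨hlen, hle, hstrict⟩ := h
  have hk : 0 < xs.length := List.length_pos_of_ne_nil hne
  have hK : 0 < ys.length := hk.trans_le hlen
  have hfirst {i : ℕ} (hi : i < ys.length) :
      le (ys.getD i d) (xs.getD (xs.length * i / ys.length) d) := by
    have hj : xs.length * i / ys.length < xs.length :=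
      Nat.div_lt_of_lt_mul (by rw [mul_comm]; exact Nat.mul_lt_mul_of_pos_right hi hk)
    obtain ⟨h₁, h₂⟩ := (mem_block_iff (i := i) hk hK).2 rfl
    simpa [hi, hj] using hle ⟨_, hj⟩ ⟨i, hi⟩ h₁ h₂
  have hsorted {i j : ℕ} (hij : i < j) (hj : j < xs.length) :
      lt (xs.getD i d) (xs.getD j d) := by
    simpa [hj, hij.trans hj] using List.pairwise_iff_getElem.1 hs i j (hij.trans hj) hj hij
  refine ⟨fun p hp => ?_, ?_⟩
  · have hi : p / xs.length < ys.length := Nat.div_lt_of_lt_mul hp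
    have hj : p / ys.length < xs.length := Nat.div_lt_of_lt_mul (by rwa [mul_comm])
    have hmono : xs.length * (p / xs.length) / ys.length ≤ p / ys.length :=
      Nat.div_le_div_right (Nat.mul_div_le p _)
    rcases hmono.eq_or_lt with heq | hlt
    · exact heq ▸ hfirst hi
    · exact hlt_le (htrans (hfirst hi) (hsorted hlt hj))
  · rcases hstrict with ⟨j, i, h₁, h₂, hlt⟩ | hdvd
    · refine ⟨xs.length * i, Nat.mul_lt_mul_of_pos_left i.isLt hk, ?_⟩
      rw [(mem_block_iff hk hK).1 ⟨h₁, h₂⟩, Nat.mul_div_cancel_left _ hk]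
      simpa using hlt
    · have hk1 : 1 < xs.length := by
        by_contra hcon
        exact hdvd (by rw [show xs.length = 1 by omega]; exact one_dvd _)
      have hlt : xs.length * (ys.length / xs.length) < ys.length :=
        (Nat.mul_div_le _ _).lt_of_ne fun heq => hdvd ⟨_, heq.symm⟩
      have h₀ := hfirst (Nat.div_lt_self hK hk1)
      rw [Nat.div_eq_of_lt hlt] at h₀
      refine ⟨ys.length, lt_mul_of_one_lt_left hK hk1, ?_⟩
      rw [Nat.div_self hK]
      exact htrans h₀ (hsorted one_pos hk1)

/-- Completeness of the axioms K+MD+R for match-domination: if `X`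
match-dominates `Y` according to `≻`, then `X ≻̂ Y` holds in the entailment closure
of K+MD+R and transitivity on multisets (finite subsets being viewed as multisets
with all multiplicities one). -/
theorem stmt_16 {C : Type*} [LinearOrder C] [Fintype C] [Nonempty C]
    (X Y : Finset C) (hX : X.Nonempty) (hY : Y.Nonempty)
    (h : MatchDom X Y) : KMDR true X.val Y.val := by
  obtain ⟨d⟩ := ‹Nonempty C›
  have hcoe (Z : Finset C) : (Z.sort (· ≤ ·) : Multiset C) = Z.val := Z.sort_eq (· ≤ ·)
  have hcoe' (Z : Finset C) : ((Z.sort (· ≤ ·)).reverse : Multiset C) = Z.val := by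
    rw [Multiset.coe_reverse, hcoe]
  have hnil {Z : Finset C} (hZ : Z.Nonempty) : Z.sort (· ≤ ·) ≠ [] := fun hcon =>
    hZ.card_pos.ne' (by rw [← Z.length_sort (· ≤ ·), hcon, List.length_nil])
  unfold MatchDom at h
  split_ifs at h
  · obtain ⟨hle, hlt⟩ := h.getD (hnil hX) X.sortedLT_sort.pairwise le_of_lt lt_of_le_of_lt d
    exact .of_getD hX hY (hcoe X) (hcoe Y) d hle hlt
  · obtain ⟨hle, hlt⟩ := h.getD (by simpa using hnil hY)
      (List.pairwise_reverse.2 Y.sortedLT_sort.pairwise) le_of_lt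
      (fun hab hbc => lt_of_lt_of_le hbc hab) d
    rw [mul_comm] at hle hlt
    exact .of_getD hX hY (hcoe' X) (hcoe' Y) d hle hlt
end

section
/- (Structure of single-voter moves in Plurality.) Let a and a' be Plurality profiles on the same finite voter set V that differ only in the vote of a single voter, and let X = f(a) and Y = f(a') be the corresponding winner sets. Then at least one of the following holds: |X| = 1, or |Y| = 1, or both |X ∖ Y| ≤ 1 and |Y ∖ X| ≤ 1 (i.e., the winner set changes by at most one candidate added, removed, or swapped). -/
/-- The Plurality score of candidate `c` under profile `a : V → C`. -/
def score {C V : Type*} [DecidableEq C] [Fintype V] (a : V → C) (c : C) : ℕ :=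
  (Finset.univ.filter fun v => a v = c).card

/-- The winner set `f(a)`: the candidates with maximal Plurality score. -/
def winners {C V : Type*} [DecidableEq C] [Fintype C] [Fintype V] (a : V → C) : Finset C :=
  Finset.univ.filter fun c => ∀ d : C, score a d ≤ score a c

theorem score_eq_card_erase_add {C V : Type*} [DecidableEq C] [Fintype V] [DecidableEq V]
    (a : V → C) (i : V) (c : C) :
    score a c =
      ((Finset.univ.erase i).filter fun v => a v = c).card + if a i = c then 1 else 0 := by
  unfold score
  rw [← Finset.insert_erase (Finset.mem_univ i), Finset.filter_insert]
  split_ifs <;> simp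

/-- If the new profile has no unique winner, a single-voter move can only remove from the winner
set the candidate that loses the vote. -/
theorem winners_sdiff_subset {C V : Type*} [DecidableEq C] [Fintype C] [Fintype V]
    (a a' : V → C) (i : V) (hdiff : ∀ v : V, v ≠ i → a v = a' v)
    (hcard : (winners a').card ≠ 1) : winners a \ winners a' ⊆ {a i} := by
  classical
  obtain ⟨s, hs, hs'⟩ : ∃ s : C → ℕ, (∀ c, score a c = s c + if a i = c then 1 else 0) ∧
      ∀ c, score a' c = s c + if a' i = c then 1 else 0 := by
    refine ⟨_, score_eq_card_erase_add a i, fun c => ?_⟩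
    rw [score_eq_card_erase_add a' i c]
    congr 2
    refine Finset.filter_congr fun v hv => ?_
    rw [hdiff v (Finset.ne_of_mem_erase hv)]
  intro c hc
  simp only [winners, Finset.mem_sdiff, Finset.mem_filter, Finset.mem_univ, true_and, hs, hs',
    Finset.mem_singleton] at hc ⊢
  by_contra hne
  obtain ⟨hmax, hnot⟩ := hc
  have hbase : ∀ d, s d ≤ s c := fun d => by
    have := hmax d
    grind
  have htop : s c ≤ s (a' i) := by
    by_contra! hlt
    refine hnot fun d => ?_
    have := hbase d
    grind
  refine hcard (Finset.card_eq_one.mpr ⟨a' i, ?_⟩)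
  ext d
  simp only [winners, Finset.mem_filter, Finset.mem_univ, true_and, hs', Finset.mem_singleton]
  constructor
  · intro hd
    have := hd (a' i)
    have := hbase d
    grind
  · rintro rfl e
    have := hbase e
    grind

/-- Structure of single-voter moves in Plurality: if profiles `a, a'`
on the same voter set differ only in the vote of a single voter `i`, and `X = f(a)`,
`Y = f(a')`, then `|X| = 1`, or `|Y| = 1`, or the winner set changes by at most one
candidate (`|X ∖ Y| ≤ 1` and `|Y ∖ X| ≤ 1`). -/
theorem stmt_18 {C V : Type*} [DecidableEq C] [Fintype C] [Nonempty C] [Fintype V]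
    (a a' : V → C) (i : V) (hdiff : ∀ v : V, v ≠ i → a v = a' v) :
    (winners a).card = 1 ∨ (winners a').card = 1 ∨
      (((winners a) \ (winners a')).card ≤ 1 ∧ ((winners a') \ (winners a)).card ≤ 1) := by
  by_cases hX : (winners a).card = 1
  · exact Or.inl hX
  by_cases hY : (winners a').card = 1
  · exact Or.inr (Or.inl hY)
  refine Or.inr (Or.inr ⟨?_, ?_⟩)
  · exact Finset.card_le_card (winners_sdiff_subset a a' i hdiff hY)
  · exact Finset.card_le_card
      (winners_sdiff_subset a' a i (fun v hv => (hdiff v hv).symm) hX)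
end
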